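/- Let (X,d) be a finite metric space, let K ⊆ X be a nonempty set of terminals, let p ≥ 1 be a real number, let α ≥ 1 and β ≥ 1 be real numbers, and let m₁, m₂ be natural numbers. Suppose g : X → ℝ^{m₁} satisfies ‖g(x)−g(y)‖_p ≤ d(x,y) and ‖g(x)−g(y)‖_p ≥ d(x,y)/β for all x,y ∈ X, and suppose f̂ : X → ℝ^{m₂} satisfies ‖f̂(x)−f̂(y)‖_p ≤ d(x,y) for all x,y ∈ X and ‖f̂(s)−f̂(t)‖_p ≥ d(s,t)/α for all s,t ∈ K. Then there exists F : X → ℝ^{m₁+m₂+1} such that: (i) for all x,y ∈ X, ‖F(x)−F(y)‖_p ≤ 3^{1/p}·d(x,y); (ii) for all x,y ∈ X, ‖F(x)−F(y)‖_p ≥ d(x,y)/β; and (iii) for all t ∈ K and x ∈ X, ‖F(t)−F(x)‖_p ≥ d(t,x)/(3α). -/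

import Mathlib

/-- The ℓ_p norm (for a real exponent `p`) of a vector in `ℝ^m`. -/
noncomputable def lpNorm {m : ℕ} (p : ℝ) (x : Fin m → ℝ) : ℝ :=
  (∑ i, |x i| ^ p) ^ (1 / p)

theorem sum_rpow_abs_nonneg {m : ℕ} (p : ℝ) (x : Fin m → ℝ) : 0 ≤ ∑ i, |x i| ^ p :=
  Finset.sum_nonneg fun _ _ => Real.rpow_nonneg (abs_nonneg _) _

theorem lpNorm_nonneg {m : ℕ} (p : ℝ) (x : Fin m → ℝ) : 0 ≤ lpNorm p x :=
  Real.rpow_nonneg (sum_rpow_abs_nonneg p x) _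

theorem lpNorm_rpow {m : ℕ} {p : ℝ} (hp : 1 ≤ p) (x : Fin m → ℝ) :
    lpNorm p x ^ p = ∑ i, |x i| ^ p := by
  rw [lpNorm, ← Real.rpow_mul (sum_rpow_abs_nonneg p x), one_div_mul_cancel (by linarith),
    Real.rpow_one]

theorem lpNorm_add_le {m : ℕ} {p : ℝ} (hp : 1 ≤ p) (x y : Fin m → ℝ) :
    lpNorm p (x + y) ≤ lpNorm p x + lpNorm p y :=
  Real.Lp_add_le Finset.univ x y hp

theorem lpNorm_sub_le_lpNorm_sub_add {m : ℕ} {p : ℝ} (hp : 1 ≤ p) (x y z : Fin m → ℝ) :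
    lpNorm p (x - z) ≤ lpNorm p (x - y) + lpNorm p (y - z) := by
  simpa using lpNorm_add_le hp (x - y) (y - z)

/-- The concatenation of two vectors and a scalar. -/
def appendSnoc {m n : ℕ} (x : Fin m → ℝ) (y : Fin n → ℝ) (a : ℝ) : Fin (m + n + 1) → ℝ :=
  Fin.snoc (α := fun _ => ℝ) (Fin.append x y) a

theorem lpNorm_appendSnoc_sub_rpow {m n : ℕ} {p : ℝ} (hp : 1 ≤ p) (x x' : Fin m → ℝ)
    (y y' : Fin n → ℝ) (a a' : ℝ) :
    lpNorm p (appendSnoc x y a - appendSnoc x' y' a') ^ p =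
      lpNorm p (x - x') ^ p + lpNorm p (y - y') ^ p + |a - a'| ^ p := by
  simp only [lpNorm_rpow hp, Fin.sum_univ_castSucc, Fin.sum_univ_add, appendSnoc, Pi.sub_apply,
    Fin.snoc_castSucc, Fin.snoc_last, Fin.append_left, Fin.append_right]

theorem abs_infDist_sub_infDist_le {X : Type*} [PseudoMetricSpace X] (K : Set X) (x y : X) :
    |Metric.infDist x K - Metric.infDist y K| ≤ dist x y := by
  simpa [Real.dist_eq] using (Metric.lipschitz_infDist_pt K).dist_le_mul x y

/-- Strong terminal embedding into ℓ_p: given a non-expansive embedding `g` of `X` with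
contraction `β` and a non-expansive map `f̂` whose restriction to the terminals `K` has
contraction `α`, their concatenation (together with the distance-to-`K` coordinate) yields
a map into `ℝ^(m₁+m₂+1)` with expansion `3^(1/p)`, contraction `β` on all pairs, and
contraction `3α` on pairs containing a terminal. -/
theorem strong_terminal_embedding_lp {X : Type} [MetricSpace X] [Fintype X]
    (K : Set X) (hK : K.Nonempty) (p α β : ℝ)
    (hp : 1 ≤ p) (hα : 1 ≤ α) (hβ : 1 ≤ β)
    (m₁ m₂ : ℕ) (g : X → Fin m₁ → ℝ) (f : X → Fin m₂ → ℝ)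
    (hg1 : ∀ x y : X, lpNorm p (g x - g y) ≤ dist x y)
    (hg2 : ∀ x y : X, dist x y / β ≤ lpNorm p (g x - g y))
    (hf1 : ∀ x y : X, lpNorm p (f x - f y) ≤ dist x y)
    (hf2 : ∀ s ∈ K, ∀ t ∈ K, dist s t / α ≤ lpNorm p (f s - f t)) :
    ∃ F : X → Fin (m₁ + m₂ + 1) → ℝ,
      (∀ x y : X, lpNorm p (F x - F y) ≤ (3 : ℝ) ^ (1 / p) * dist x y) ∧
      (∀ x y : X, dist x y / β ≤ lpNorm p (F x - F y)) ∧
      (∀ t ∈ K, ∀ x : X, dist t x / (3 * α) ≤ lpNorm p (F t - F x)) := by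
  have hp0 : 0 < p := by linarith
  set F : X → Fin (m₁ + m₂ + 1) → ℝ :=
    fun x => appendSnoc (g x) (f x) (Metric.infDist x K)
  have key (x y : X) : lpNorm p (F x - F y) ^ p = lpNorm p (g x - g y) ^ p +
      lpNorm p (f x - f y) ^ p + |Metric.infDist x K - Metric.infDist y K| ^ p :=
    lpNorm_appendSnoc_sub_rpow hp _ _ _ _ _ _
  have hg0 (x y : X) := Real.rpow_nonneg (lpNorm_nonneg p (g x - g y)) p
  have hf0 (x y : X) := Real.rpow_nonneg (lpNorm_nonneg p (f x - f y)) p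
  have hd0 (x y : X) :=
    Real.rpow_nonneg (abs_nonneg (Metric.infDist x K - Metric.infDist y K)) p
  have hFg (x y : X) : lpNorm p (g x - g y) ≤ lpNorm p (F x - F y) := by
    rw [← Real.rpow_le_rpow_iff (lpNorm_nonneg _ _) (lpNorm_nonneg _ _) hp0, key]
    linarith [hf0 x y, hd0 x y]
  have hFf (x y : X) : lpNorm p (f x - f y) ≤ lpNorm p (F x - F y) := by
    rw [← Real.rpow_le_rpow_iff (lpNorm_nonneg _ _) (lpNorm_nonneg _ _) hp0, key]
    linarith [hg0 x y, hd0 x y]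
  have hFd (x y : X) : |Metric.infDist x K - Metric.infDist y K| ≤ lpNorm p (F x - F y) := by
    rw [← Real.rpow_le_rpow_iff (abs_nonneg _) (lpNorm_nonneg _ _) hp0, key]
    linarith [hf0 x y, hg0 x y]
  refine ⟨F, fun x y => ?_, fun x y => (hg2 x y).trans (hFg x y), fun t ht x => ?_⟩
  · rw [← Real.rpow_le_rpow_iff (lpNorm_nonneg _ _) (by positivity) hp0, key,
      Real.mul_rpow (by positivity) dist_nonneg, ← Real.rpow_mul (by norm_num),
      one_div_mul_cancel hp0.ne', Real.rpow_one]
    linarith [Real.rpow_le_rpow (lpNorm_nonneg _ _) (hg1 x y) hp0.le,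
      Real.rpow_le_rpow (lpNorm_nonneg _ _) (hf1 x y) hp0.le,
      Real.rpow_le_rpow (abs_nonneg _) (abs_infDist_sub_infDist_le K x y) hp0.le]
  · obtain ⟨k, hk, hkx⟩ := K.toFinite.isCompact.exists_infDist_eq_dist hK x
    have hα0 : 0 < α := by linarith
    have hdk : dist x k ≤ lpNorm p (F t - F x) := by
      have h := hFd t x
      rwa [Metric.infDist_zero_of_mem ht, hkx, zero_sub, abs_neg, abs_of_nonneg dist_nonneg] at h
    have htk : lpNorm p (f t - f k) ≤ lpNorm p (F t - F x) + dist x k :=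
      (lpNorm_sub_le_lpNorm_sub_add hp _ (f x) _).trans (add_le_add (hFf t x) (hf1 x k))
    have htk' := (div_le_iff₀ hα0).1 ((hf2 t ht k hk).trans htk)
    rw [div_le_iff₀ (by positivity)]
    nlinarith [dist_triangle t k x, dist_comm x k, lpNorm_nonneg p (F t - F x),
      mul_le_mul_of_nonneg_right hdk hα0.le]
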